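/- arXiv:2604.14669 — 2 statements merged into one kernel-verified Lean document; each statement's English description precedes it below -/
import Mathlib

section
/- Let T be the ZO-GDM covariance operator on (𝕊²)^d, and define S(η,β) := Σ_{i=1}^d η λ_i / (2(1−β)(1 − ηλ_i/(1−β²))). Then the spectral radius satisfies ρ(T) < 1 if and only if η λ_1 < 1 − β² and S(η,β) < 1. -/
open Matrix

noncomputable instance : NormedAddCommGroup (Matrix (Fin 2) (Fin 2) ℝ) :=
  inferInstanceAs (NormedAddCommGroup (Fin 2 → Fin 2 → ℝ))

noncomputable instance : NormedSpace ℝ (Matrix (Fin 2) (Fin 2) ℝ) :=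
  inferInstanceAs (NormedSpace ℝ (Fin 2 → Fin 2 → ℝ))

/-- The space `𝕊²` of 2×2 real symmetric matrices, as a submodule of the 2×2 matrices. -/
def Sym2Mat : Submodule ℝ (Matrix (Fin 2) (Fin 2) ℝ) where
  carrier := {X | X.IsSymm}
  add_mem' := fun hA hB => hA.add hB
  zero_mem' := Matrix.isSymm_zero
  smul_mem' := fun c _ hX => hX.smul c

/-- The matrix `A = [[1−ηλ, −β],[ηλ, β]]`. -/
def Amat (η β l : ℝ) : Matrix (Fin 2) (Fin 2) ℝ := !![1 - η * l, -β; η * l, β]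

/-- The matrix `Q = [[1,−1],[−1,1]]`. -/
def Qmat : Matrix (Fin 2) (Fin 2) ℝ := !![1, -1; -1, 1]

/-- The quadratic form of a block. -/
def zqf (V : Sym2Mat) (s t : ℝ) : ℝ :=
  s ^ 2 * (V : Matrix (Fin 2) (Fin 2) ℝ) 0 0 + 2 * s * t * (V : Matrix (Fin 2) (Fin 2) ℝ) 0 1
    + t ^ 2 * (V : Matrix (Fin 2) (Fin 2) ℝ) 1 1

lemma zqf_add (V W : Sym2Mat) (s t : ℝ) : zqf (V + W) s t = zqf V s t + zqf W s t := by
  simp [zqf]; ring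

lemma zqf_sub (V W : Sym2Mat) (s t : ℝ) : zqf (V - W) s t = zqf V s t - zqf W s t := by
  simp [zqf]; ring

lemma zqf_smul (c : ℝ) (W : Sym2Mat) (s t : ℝ) : zqf (c • W) s t = c * zqf W s t := by
  simp [zqf]; ring

/-- Build a symmetric matrix. -/
def zmk (a b c : ℝ) : Sym2Mat := ⟨!![a, b; b, c], by
  show Matrix.IsSymm _
  ext i j; fin_cases i <;> fin_cases j <;> rfl⟩

lemma zqf_zmk (a b c s t : ℝ) : zqf (zmk a b c) s t = s ^ 2 * a + 2 * s * t * b + t ^ 2 * c := by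
  simp [zqf, zmk]

lemma zsym (V : Sym2Mat) :
    (V : Matrix (Fin 2) (Fin 2) ℝ) 1 0 = (V : Matrix (Fin 2) (Fin 2) ℝ) 0 1 := by
  have h : (V : Matrix (Fin 2) (Fin 2) ℝ).IsSymm := V.2
  exact h.apply 0 1

lemma zentry_le {d : ℕ} (V : Fin d → Sym2Mat) (i : Fin d) (a b : Fin 2) :
    |(V i : Matrix (Fin 2) (Fin 2) ℝ) a b| ≤ ‖V‖ := by
  have h1 : ‖V i‖ ≤ ‖V‖ := norm_le_pi_norm V i
  have h2 : ‖(show Fin 2 → Fin 2 → ℝ from (V i : Matrix (Fin 2) (Fin 2) ℝ)) a‖ ≤ ‖V i‖ :=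
    norm_le_pi_norm (show Fin 2 → Fin 2 → ℝ from (V i : Matrix (Fin 2) (Fin 2) ℝ)) a
  have h3 := norm_le_pi_norm ((show Fin 2 → Fin 2 → ℝ from (V i : Matrix (Fin 2) (Fin 2) ℝ)) a) b
  exact h3.trans (h2.trans h1)

lemma znorm_le {d : ℕ} (V : Fin d → Sym2Mat) (B : ℝ) (hB : 0 ≤ B)
    (h : ∀ i a b, |(V i : Matrix (Fin 2) (Fin 2) ℝ) a b| ≤ B) : ‖V‖ ≤ B := by
  refine (pi_norm_le_iff_of_nonneg hB).2 fun i => ?_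
  have : ‖(show Fin 2 → Fin 2 → ℝ from (V i : Matrix (Fin 2) (Fin 2) ℝ))‖ ≤ B :=
    (pi_norm_le_iff_of_nonneg hB).2 fun a => (pi_norm_le_iff_of_nonneg hB).2 fun b => h i a b
  exact this

lemma zqf_le {d : ℕ} (V : Fin d → Sym2Mat) (i : Fin d) (s t : ℝ) :
    |zqf (V i) s t| ≤ 2 * ‖V‖ * (s ^ 2 + t ^ 2) := by
  have h1 := zentry_le V i 0 0
  have h2 := zentry_le V i 0 1
  have h3 := zentry_le V i 1 1
  unfold zqf
  generalize (V i : Matrix (Fin 2) (Fin 2) ℝ) 0 0 = a at *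
  generalize (V i : Matrix (Fin 2) (Fin 2) ℝ) 0 1 = b at *
  generalize (V i : Matrix (Fin 2) (Fin 2) ℝ) 1 1 = c at *
  generalize ‖V‖ = N at *
  have k1 : |s ^ 2 * a| ≤ s ^ 2 * N := by
    rw [abs_mul, abs_of_nonneg (sq_nonneg s)]; gcongr
  have k3 : |t ^ 2 * c| ≤ t ^ 2 * N := by
    rw [abs_mul, abs_of_nonneg (sq_nonneg t)]; gcongr
  have k2 : |2 * s * t * b| ≤ (s ^ 2 + t ^ 2) * N := by
    rw [abs_mul]
    have : |2 * s * t| ≤ s ^ 2 + t ^ 2 := by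
      rw [abs_le]; constructor <;> nlinarith [sq_nonneg (s - t), sq_nonneg (s + t)]
    gcongr
  rw [abs_le] at *
  constructor <;> linarith

lemma znorm_le_of_qf {d : ℕ} (V : Fin d → Sym2Mat) (B : ℝ) (hB : 0 ≤ B)
    (h : ∀ i s t, |zqf (V i) s t| ≤ B * (s ^ 2 + t ^ 2)) : ‖V‖ ≤ 2 * B := by
  refine znorm_le V _ (by linarith) fun i => ?_
  have h1 := h i 1 0
  have h2 := h i 0 1
  have h3 := h i 1 1
  simp only [zqf] at h1 h2 h3
  have h4 := zsym (V i)
  rw [abs_le] at h1 h2 h3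
  intro a b
  rw [abs_le]
  fin_cases a <;> fin_cases b <;> constructor <;> simp only [Fin.zero_eta, Fin.mk_one, h4, Fin.isValue] <;> linarith

section
variable {d : ℕ} (η β : ℝ) (lam : Fin d → ℝ)

/-- The defining equation of the operator. -/
def ZEq (T : (Fin d → Sym2Mat) →L[ℝ] (Fin d → Sym2Mat)) : Prop :=
  ∀ (W : Fin d → Sym2Mat) (i : Fin d),
      ((T W i : Matrix (Fin 2) (Fin 2) ℝ))
        = Amat η β (lam i) * (W i : Matrix (Fin 2) (Fin 2) ℝ) * (Amat η β (lam i))ᵀ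
          + (η ^ 2 * (lam i ^ 2 * (W i : Matrix (Fin 2) (Fin 2) ℝ) 0 0
              + ∑ j, lam j ^ 2 * (W j : Matrix (Fin 2) (Fin 2) ℝ) 0 0)) • Qmat

variable {η β lam} {T : (Fin d → Sym2Mat) →L[ℝ] (Fin d → Sym2Mat)}

lemma ZEq.qf (hT : ZEq η β lam T) (W : Fin d → Sym2Mat) (i : Fin d) (s t : ℝ) :
    zqf (T W i) s t = zqf (W i) ((1 - η * lam i) * s + η * lam i * t) (β * (t - s))
      + ((η * lam i) ^ 2 * (W i : Matrix (Fin 2) (Fin 2) ℝ) 0 0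
        + ∑ j, (η * lam j) ^ 2 * (W j : Matrix (Fin 2) (Fin 2) ℝ) 0 0) * (s - t) ^ 2 := by
  have hs : ∑ j, (η * lam j) ^ 2 * (W j : Matrix (Fin 2) (Fin 2) ℝ) 0 0
      = η ^ 2 * ∑ j, lam j ^ 2 * (W j : Matrix (Fin 2) (Fin 2) ℝ) 0 0 := by
    rw [Finset.mul_sum]; exact Finset.sum_congr rfl fun j _ => by ring
  rw [hs]
  have h4 := zsym (W i)
  simp only [zqf, hT W i]
  simp only [Amat, Qmat, Matrix.add_apply, Matrix.smul_apply, Matrix.mul_apply,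
    Matrix.transpose_apply, Fin.sum_univ_two, h4, smul_eq_mul, Matrix.of_apply, Matrix.cons_val',
    Matrix.cons_val_zero, Matrix.cons_val_one, Matrix.cons_val_fin_one]
  ring

/-- Membership in the PSD cone. -/
def ZP (W : Fin d → Sym2Mat) : Prop := ∀ i s t, 0 ≤ zqf (W i) s t

lemma ZP.diag {W : Fin d → Sym2Mat} (h : ZP W) (i : Fin d) :
    0 ≤ (W i : Matrix (Fin 2) (Fin 2) ℝ) 0 0 := by
  simpa [zqf] using h i 1 0

lemma ZEq.qf_ge (hT : ZEq η β lam T) {W : Fin d → Sym2Mat} (h : ZP W) (i : Fin d) (s t : ℝ) :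
    zqf (W i) ((1 - η * lam i) * s + η * lam i * t) (β * (t - s)) ≤ zqf (T W i) s t := by
  rw [hT.qf]
  have h1 := h.diag
  have : 0 ≤ ∑ j, (η * lam j) ^ 2 * (W j : Matrix (Fin 2) (Fin 2) ℝ) 0 0 :=
    Finset.sum_nonneg fun j _ => mul_nonneg (sq_nonneg _) (h1 j)
  have h2 := h1 i
  have : 0 ≤ ((η * lam i) ^ 2 * (W i : Matrix (Fin 2) (Fin 2) ℝ) 0 0
        + ∑ j, (η * lam j) ^ 2 * (W j : Matrix (Fin 2) (Fin 2) ℝ) 0 0) * (s - t) ^ 2 := by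
    positivity
  linarith

lemma ZEq.map (hT : ZEq η β lam T) {W : Fin d → Sym2Mat} (h : ZP W) : ZP (T W) :=
  fun i s t => (h i _ _).trans (hT.qf_ge h i s t)

lemma ZEq.map_pow (hT : ZEq η β lam T) {W : Fin d → Sym2Mat} (h : ZP W) (n : ℕ) :
    ZP ((T ^ n) W) := by
  induction n with
  | zero => simpa using h
  | succ n ih => rw [pow_succ']; exact hT.map ih

/-- The constant family `Q`. -/
def zQ : Fin d → Sym2Mat := fun _ => zmk 1 (-1) 1

lemma zqf_zQ (i : Fin d) (s t : ℝ) : zqf (zQ i) s t = (s - t) ^ 2 := by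
  rw [zQ, zqf_zmk]; ring

lemma zQ_ZP : ZP (zQ : Fin d → Sym2Mat) := fun i s t => by rw [zqf_zQ]; positivity

lemma zforward (hd : 0 < d) (hη : 0 < η) (hβ : β ∈ Set.Ico (0 : ℝ) 1)
    (hpos : ∀ i, 0 < lam i) (hT : ZEq η β lam T) (W : Fin d → Sym2Mat)
    (hW0 : ∀ i, 0 ≤ (W i : Matrix (Fin 2) (Fin 2) ℝ) 0 0) (hW : W = T W + zQ) :
    η * lam ⟨0, hd⟩ < 1 - β ^ 2 ∧
      ∑ i, η * lam i / (2 * (1 - β) * (1 - η * lam i / (1 - β ^ 2))) < 1 := by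
  obtain ⟨hb0, hb1⟩ := hβ
  set κ := ∑ j, (η * lam j) ^ 2 * (W j : Matrix (Fin 2) (Fin 2) ℝ) 0 0 with hκ
  have hκ0 : 0 ≤ κ := Finset.sum_nonneg fun j _ => mul_nonneg (sq_nonneg _) (hW0 j)
  have hb2 : 0 < 1 - β ^ 2 := by nlinarith
  have key : ∀ i, 2 * (W i : Matrix (Fin 2) (Fin 2) ℝ) 0 0 * (η * lam i) *
      ((1 - β) * (1 - η * lam i / (1 - β ^ 2))) = κ + 1 := by
    intro i
    have e : ∀ s t, zqf (W i) s t = zqf (T W i) s t + (s - t) ^ 2 := by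
      intro s t
      conv_lhs => rw [hW]
      rw [Pi.add_apply, zqf_add, zqf_zQ]
    simp only [hT.qf, ← hκ] at e
    have e1 := e 1 1
    have e2 := e 1 0
    have e3 := e 0 1
    simp only [zqf] at e1 e2 e3
    generalize (W i : Matrix (Fin 2) (Fin 2) ℝ) 0 0 = a at *
    generalize (W i : Matrix (Fin 2) (Fin 2) ℝ) 0 1 = b at *
    generalize (W i : Matrix (Fin 2) (Fin 2) ℝ) 1 1 = c at *
    generalize η * lam i = x at *
    have hc : c = -2 * b := by linarith
    have hb : b * (1 + β) = - x * a := by subst hc; nlinarith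
    have hb' : b = - x * a / (1 + β) := by
      rw [eq_div_iff (by linarith)]; exact hb
    have h1 : (1 : ℝ) + β ≠ 0 := by linarith
    have h2 : (1 : ℝ) - β ≠ 0 := by linarith
    have : (1 : ℝ) - β ^ 2 = (1 - β) * (1 + β) := by ring
    subst hc
    rw [hb'] at e3
    rw [this]
    field_simp at e3 ⊢
    linear_combination e3
  have hx : ∀ i, 0 < η * lam i := fun i => mul_pos hη (hpos i)
  have hD : ∀ i, 0 < 1 - η * lam i / (1 - β ^ 2) := by
    intro i
    by_contra hcon
    push Not at hcon
    have h1 := key i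
    have h2 : 0 ≤ 2 * (W i : Matrix (Fin 2) (Fin 2) ℝ) 0 0 * (η * lam i) * (1 - β) :=
      mul_nonneg (mul_nonneg (mul_nonneg (by norm_num) (hW0 i)) (hx i).le) (by linarith)
    nlinarith
  refine ⟨?_, ?_⟩
  · have := hD ⟨0, hd⟩
    rw [sub_pos, div_lt_one hb2] at this
    exact this
  · have hS : (κ + 1) * ∑ i, η * lam i / (2 * (1 - β) * (1 - η * lam i / (1 - β ^ 2))) = κ := by
      conv_rhs => rw [hκ]
      rw [Finset.mul_sum]
      refine Finset.sum_congr rfl fun i _ => ?_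
      have hne : 2 * (1 - β) * (1 - η * lam i / (1 - β ^ 2)) ≠ 0 :=
        (mul_pos (by linarith) (hD i)).ne'
      rw [← key i, ← mul_div_assoc, div_eq_iff hne]
      ring
    nlinarith

lemma zbackward (hη : 0 < η) (hβ : β ∈ Set.Ico (0 : ℝ) 1)
    (hpos : ∀ i, 0 < lam i) (hT : ZEq η β lam T)
    (hl : ∀ i, η * lam i < 1 - β ^ 2)
    (hS : ∑ i, η * lam i / (2 * (1 - β) * (1 - η * lam i / (1 - β ^ 2))) < 1) :
    ∃ (W : Fin d → Sym2Mat) (ε : ℝ), 0 < ε ∧ ZP W ∧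
      ∀ i s t, zqf ((T ^ 2) W i) s t ≤ zqf (W i) s t - ε * (s ^ 2 + t ^ 2) := by
  obtain ⟨hb0, hb1⟩ := hβ
  have hb2 : 0 < 1 - β ^ 2 := by nlinarith
  have hx : ∀ i, 0 < η * lam i := fun i => mul_pos hη (hpos i)
  have hD : ∀ i, 0 < 1 - η * lam i / (1 - β ^ 2) := by
    intro i
    rw [sub_pos, div_lt_one hb2]
    exact hl i
  have hDD : ∀ i, 0 < 2 * (1 - β) * (1 - η * lam i / (1 - β ^ 2)) := fun i =>
    mul_pos (by linarith) (hD i)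
  set S := ∑ i, η * lam i / (2 * (1 - β) * (1 - η * lam i / (1 - β ^ 2))) with hSdef
  set a : Fin d → ℝ := fun i => 1 / (η * lam i * (2 * (1 - β) * (1 - η * lam i / (1 - β ^ 2))))
    with ha
  set W : Fin d → Sym2Mat := fun i =>
    zmk (a i) (-(η * lam i) * a i / (1 + β)) (2 * (η * lam i) * a i / (1 + β)) with hW
  have hW00 : ∀ i, (W i : Matrix (Fin 2) (Fin 2) ℝ) 0 0 = a i := fun i => by simp [hW, zmk]
  have hκ : ∑ j, (η * lam j) ^ 2 * (W j : Matrix (Fin 2) (Fin 2) ℝ) 0 0 = S := by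
    refine Finset.sum_congr rfl fun j _ => ?_
    rw [hW00]
    have h1 := (hDD j).ne'
    have h2 := (hx j).ne'
    simp only [ha]
    rw [mul_one_div, div_eq_div_iff (mul_ne_zero h2 h1) h1]
    ring
  have ha0 : ∀ i, 0 < a i := fun i => by
    simp only [ha]; exact one_div_pos.2 (mul_pos (hx i) (hDD i))
  have hWP : ZP W := by
    intro i s t
    simp only [hW, zqf_zmk]
    have h0 := ha0 i
    have h1 := hx i
    have h2 := hl i
    generalize η * lam i = x at *
    have hy : 0 < x / (1 + β) := by positivity
    have hy1 : x / (1 + β) < 1 := by rw [div_lt_one (by linarith)]; nlinarith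
    have e : s ^ 2 * a i + 2 * s * t * (-x * a i / (1 + β)) + t ^ 2 * (2 * x * a i / (1 + β))
      = a i * ((s - x / (1 + β) * t) ^ 2 + x / (1 + β) * (2 - x / (1 + β)) * t ^ 2) := by ring
    rw [e]
    have : 0 < 2 - x / (1 + β) := by linarith
    positivity
  have hTW : T W = W - (1 - S) • zQ := by
    have hq : ∀ i s t, zqf (T W i) s t = zqf (W i) s t - (1 - S) * (s - t) ^ 2 := by
      intro i s t
      rw [hT.qf, hκ, hW00]
      have key : a i * (η * lam i * (2 * (1 - β) * (1 - η * lam i / (1 - β ^ 2)))) = 1 := by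
        simp only [ha]
        exact one_div_mul_cancel (mul_pos (hx i) (hDD i)).ne'
      simp only [hW, zqf_zmk]
      have h1 : (1 : ℝ) + β ≠ 0 := by linarith
      have h2 : (1 : ℝ) - β ≠ 0 := by linarith
      have : (1 : ℝ) - β ^ 2 = (1 - β) * (1 + β) := by ring
      rw [this] at key
      generalize a i = a at *
      generalize η * lam i = x at *
      field_simp at key ⊢
      linear_combination (-(s - t) ^ 2) * key
    funext i
    have h1 := hq i 1 0
    have h2 := hq i 0 1
    have h3 := hq i 1 1
    have h4 := zsym (T W i)
    have h5 := zsym (W i)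
    simp only [zqf] at h1 h2 h3
    apply Subtype.ext
    ext p q
    fin_cases p <;> fin_cases q <;> simp [zQ, zmk] <;> linarith
  refine ⟨W, (1 - S) / 8, by linarith, hWP, ?_⟩
  intro i s t
  have h2 : (T ^ 2) W = W - (1 - S) • zQ - (1 - S) • T zQ := by
    rw [pow_two]
    show T (T W) = _
    rw [hTW, map_sub, map_smul, hTW]
  rw [h2]
  simp only [Pi.sub_apply, Pi.smul_apply, zqf_sub, zqf_smul, zqf_zQ]
  have h3 := hT.qf_ge (W := zQ) zQ_ZP i s t
  rw [zqf_zQ] at h3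
  have h4 : s ^ 2 + t ^ 2 ≤ 8 * ((s - t) ^ 2 + zqf (T zQ i) s t) := by
    have hk1 : β - η * lam i ≤ 1 := by have := hx i; linarith
    have hk2 : -1 ≤ β - η * lam i := by have := hl i; nlinarith
    have e : (1 - η * lam i) * s + η * lam i * t - β * (t - s)
      = s + (β - η * lam i) * (s - t) := by ring
    rw [e] at h3
    generalize β - η * lam i = k at *
    have hk : k ^ 2 * (s - t) ^ 2 ≤ 1 * (s - t) ^ 2 := by
      gcongr; nlinarith
    have hs : s ^ 2 ≤ 2 * (s + k * (s - t)) ^ 2 + 2 * (k ^ 2 * (s - t) ^ 2) := by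
      nlinarith [sq_nonneg (s + 2 * (k * (s - t)))]
    have ht : t ^ 2 ≤ 2 * s ^ 2 + 2 * (s - t) ^ 2 := by nlinarith [sq_nonneg (2 * s - t)]
    nlinarith
  have h5 := mul_le_mul_of_nonneg_left h4 (by linarith : 0 ≤ (1 - S) / 8)
  linarith

lemma zbound (hT : ZEq η β lam T) (W : Fin d → Sym2Mat) (ε : ℝ) (hε : 0 < ε) (hW : ZP W)
    (h : ∀ i s t, zqf ((T ^ 2) W i) s t ≤ zqf (W i) s t - ε * (s ^ 2 + t ^ 2)) :
    ∃ K θ : ℝ, 0 < K ∧ 0 ≤ θ ∧ θ < 1 ∧ ∀ n : ℕ, ‖T ^ (2 * n)‖ ≤ K * θ ^ n := by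
  set M := 2 * ‖W‖ + ε with hM
  have hN : 0 ≤ ‖W‖ := norm_nonneg W
  have hM0 : 0 < M := by positivity
  have hWM : ∀ i s t, zqf (W i) s t ≤ M * (s ^ 2 + t ^ 2) := by
    intro i s t
    have h1 := (abs_le.1 (zqf_le W i s t)).2
    have : 0 ≤ ε * (s ^ 2 + t ^ 2) := by positivity
    rw [hM]; linarith
  have hWε : ∀ i s t, ε * (s ^ 2 + t ^ 2) ≤ zqf (W i) s t := by
    intro i s t
    have := hT.map_pow hW 2 i s t
    linarith [h i s t]
  have hεM : ε / M ≤ 1 := by rw [div_le_one hM0]; linarith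
  have hεM0 : 0 < ε / M := by positivity
  set θ := 1 - ε / M with hθ
  have hθ0 : 0 ≤ θ := by linarith
  have hstep : ZP (θ • W - (T ^ 2) W) := by
    intro i s t
    simp only [Pi.sub_apply, Pi.smul_apply, zqf_sub, zqf_smul]
    have h1 := h i s t
    have h2 := mul_le_mul_of_nonneg_left (hWM i s t) hεM0.le
    have h3 : ε / M * (M * (s ^ 2 + t ^ 2)) = ε * (s ^ 2 + t ^ 2) := by field_simp
    rw [h3] at h2
    rw [hθ]; linarith
  have hn : ∀ n : ℕ, ZP (θ ^ n • W - (T ^ (2 * n)) W) := by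
    intro n
    induction n with
    | zero => intro i s t; simp [zqf]
    | succ n ih =>
      have h1 := hT.map_pow hstep (2 * n)
      intro i s t
      have h2 := h1 i s t
      have h3 := mul_nonneg hθ0 (ih i s t)
      have e : (T ^ (2 * (n + 1))) W = (T ^ (2 * n)) ((T ^ 2) W) := by
        rw [show 2 * (n + 1) = 2 * n + 2 by ring, pow_add]; rfl
      rw [e]
      rw [map_sub, map_smul] at h2
      simp only [Pi.sub_apply, Pi.smul_apply, zqf_sub, zqf_smul] at h2 h3 ⊢
      rw [pow_succ]
      nlinarith
  refine ⟨2 * (2 / ε * M), θ, by positivity, hθ0, by linarith, fun n => ?_⟩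
  refine ContinuousLinearMap.opNorm_le_bound _ (by positivity) fun V => ?_
  have hV : 0 ≤ ‖V‖ := norm_nonneg V
  have hVW : ∀ i s t, |zqf (V i) s t| ≤ 2 * ‖V‖ / ε * zqf (W i) s t := by
    intro i s t
    refine (zqf_le V i s t).trans ?_
    have := mul_le_mul_of_nonneg_left (hWε i s t) (by positivity : 0 ≤ 2 * ‖V‖ / ε)
    have e : 2 * ‖V‖ / ε * (ε * (s ^ 2 + t ^ 2)) = 2 * ‖V‖ * (s ^ 2 + t ^ 2) := by field_simp
    linarith
  have hp : ZP ((2 * ‖V‖ / ε) • W + V) := by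
    intro i s t
    simp only [Pi.add_apply, Pi.smul_apply, zqf_add, zqf_smul]
    linarith [(abs_le.1 (hVW i s t)).1]
  have hm : ZP ((2 * ‖V‖ / ε) • W - V) := by
    intro i s t
    simp only [Pi.sub_apply, Pi.smul_apply, zqf_sub, zqf_smul]
    linarith [(abs_le.1 (hVW i s t)).2]
  have hp' := hT.map_pow hp (2 * n)
  have hm' := hT.map_pow hm (2 * n)
  rw [map_add, map_smul] at hp'
  rw [map_sub, map_smul] at hm'
  have hfin := znorm_le_of_qf ((T ^ (2 * n)) V) (2 * ‖V‖ / ε * (θ ^ n * M)) (by positivity) ?_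
  · refine hfin.trans (le_of_eq ?_)
    ring
  intro i s t
  have h1 := hp' i s t
  have h2 := hm' i s t
  have h3 := hn n i s t
  simp only [Pi.sub_apply, Pi.add_apply, Pi.smul_apply, zqf_sub, zqf_add, zqf_smul] at h1 h2 h3
  have h4 : zqf ((T ^ (2 * n)) W i) s t ≤ θ ^ n * (M * (s ^ 2 + t ^ 2)) :=
    (sub_nonneg.1 h3).trans (mul_le_mul_of_nonneg_left (hWM i s t) (by positivity))
  have h5 := mul_le_mul_of_nonneg_left h4 (by positivity : 0 ≤ 2 * ‖V‖ / ε)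
  rw [abs_le]
  constructor <;> linarith

lemma zrho_lt (ρ : ℝ)
    (hρ : Filter.Tendsto (fun n : ℕ => ‖T ^ n‖ ^ ((n : ℝ)⁻¹)) Filter.atTop (nhds ρ))
    (K θ : ℝ) (hK : 0 < K) (hθ0 : 0 ≤ θ) (hθ1 : θ < 1)
    (h : ∀ n : ℕ, ‖T ^ (2 * n)‖ ≤ K * θ ^ n) : ρ < 1 := by
  have hθ' : θ ^ ((2 : ℝ)⁻¹) < 1 := Real.rpow_lt_one hθ0 hθ1 (by norm_num)
  refine lt_of_le_of_lt ?_ hθ'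
  have h2 : Filter.Tendsto (fun n : ℕ => 2 * n) Filter.atTop Filter.atTop :=
    Filter.tendsto_id.const_mul_atTop' (by norm_num)
  have h3 := hρ.comp h2
  have h4 : Filter.Tendsto (fun n : ℕ => K ^ (((2 * n : ℕ) : ℝ)⁻¹) * θ ^ ((2 : ℝ)⁻¹))
      Filter.atTop (nhds (K ^ (0 : ℝ) * θ ^ ((2 : ℝ)⁻¹))) := by
    refine Filter.Tendsto.mul_const _ ?_
    refine ((Real.continuousAt_const_rpow hK.ne').tendsto).comp ?_
    exact (tendsto_inv_atTop_zero.comp tendsto_natCast_atTop_atTop).comp h2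
  rw [Real.rpow_zero, one_mul] at h4
  refine le_of_tendsto_of_tendsto h3 h4 ?_
  filter_upwards [Filter.eventually_gt_atTop 0] with n hn
  have hn' : (n : ℝ) ≠ 0 := by positivity
  calc ‖T ^ (2 * n)‖ ^ (((2 * n : ℕ) : ℝ)⁻¹) ≤ (K * θ ^ n) ^ (((2 * n : ℕ) : ℝ)⁻¹) :=
        Real.rpow_le_rpow (T ^ (2 * n)).opNorm_nonneg (h n) (by positivity)
    _ = _ := by
        rw [Real.mul_rpow hK.le (by positivity), ← Real.rpow_natCast θ n, ← Real.rpow_mul hθ0]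
        congr 2
        push_cast
        field_simp

lemma zsolve (hT : ZEq η β lam T) (ρ : ℝ)
    (hρ : Filter.Tendsto (fun n : ℕ => ‖T ^ n‖ ^ ((n : ℝ)⁻¹)) Filter.atTop (nhds ρ))
    (h1 : ρ < 1) : ∃ W : Fin d → Sym2Mat,
      (∀ i, 0 ≤ (W i : Matrix (Fin 2) (Fin 2) ℝ) 0 0) ∧ W = T W + zQ := by
  obtain ⟨r, hr, hr1⟩ := exists_between (max_lt h1 (zero_lt_one : (0 : ℝ) < 1))
  have hr0 : 0 < r := (le_max_right _ _).trans_lt hr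
  have hev : ∀ᶠ n : ℕ in Filter.atTop, ‖(T ^ n) zQ‖ ≤ r ^ n * ‖(zQ : Fin d → Sym2Mat)‖ := by
    filter_upwards [hρ.eventually_lt_const ((le_max_left _ _).trans_lt hr),
      Filter.eventually_gt_atTop 0] with n hn hn0
    refine (ContinuousLinearMap.le_opNorm _ _).trans ?_
    gcongr
    have hn' : (n : ℝ) ≠ 0 := by positivity
    have := Real.rpow_le_rpow (by positivity) hn.le (by positivity : (0 : ℝ) ≤ n)
    rwa [← Real.rpow_mul (T ^ n).opNorm_nonneg, inv_mul_cancel₀ hn', Real.rpow_one,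
      Real.rpow_natCast] at this
  have : FiniteDimensional ℝ (Fin d → Sym2Mat) := inferInstance
  have : CompleteSpace (Fin d → Sym2Mat) := FiniteDimensional.complete ℝ _
  have hsum : Summable (fun n : ℕ => (T ^ n) zQ) :=
    Summable.of_norm_bounded_eventually_nat
      ((summable_geometric_of_lt_one hr0.le hr1).mul_right _) hev
  refine ⟨∑' n, (T ^ n) zQ, ?_, ?_⟩
  · intro i
    have hlim := hsum.hasSum.tendsto_sum_nat
    have hz : ∀ n, ZP (∑ k ∈ Finset.range n, (T ^ k) zQ) := by
      intro n
      induction n with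
      | zero => intro i s t; simp [zqf]
      | succ n ih =>
        intro i s t
        rw [Finset.sum_range_succ, Pi.add_apply, zqf_add]
        exact add_nonneg (ih i s t) (hT.map_pow zQ_ZP n i s t)
    by_contra hcon
    push Not at hcon
    set L := ∑' n, (T ^ n) zQ with hL
    have hd := (tendsto_iff_norm_sub_tendsto_zero.1 hlim).eventually_lt_const (neg_pos.2 hcon)
    obtain ⟨n, hn⟩ := hd.exists
    have h2 := (abs_le.1 (zentry_le ((∑ k ∈ Finset.range n, (T ^ k) zQ) - L) i 0 0)).2
    have h3 := (hz n).diag i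
    rw [Pi.sub_apply, Submodule.coe_sub, Matrix.sub_apply] at h2
    linarith
  · rw [T.map_tsum hsum, hsum.tsum_eq_zero_add, add_comm]
    congr 1
    refine tsum_congr fun n => ?_
    rw [pow_succ']; rfl

end

/-- **Subcritical case for the ZO-GDM covariance operator.**  Let `T` be the ZO-GDM
covariance operator on `(𝕊²)^d` and `ρ` its spectral radius (the limit of `‖Tⁿ‖^{1/n}`).
With `S(η,β) = Σ_i η λ_i / (2(1−β)(1 − ηλ_i/(1−β²)))`, one has
`ρ < 1 ↔ η λ_1 < 1 − β² ∧ S(η,β) < 1`. -/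
theorem zogdm_cov_operator_spectral_radius_lt_one {d : ℕ} (hd : 0 < d)
    (η β : ℝ) (hη : 0 < η) (hβ : β ∈ Set.Ico (0 : ℝ) 1)
    (lam : Fin d → ℝ) (hmono : Antitone lam) (hpos : ∀ i, 0 < lam i)
    (T : (Fin d → Sym2Mat) →L[ℝ] (Fin d → Sym2Mat))
    (hT : ∀ (W : Fin d → Sym2Mat) (i : Fin d),
      ((T W i : Matrix (Fin 2) (Fin 2) ℝ))
        = Amat η β (lam i) * (W i : Matrix (Fin 2) (Fin 2) ℝ) * (Amat η β (lam i))ᵀ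
          + (η ^ 2 * (lam i ^ 2 * (W i : Matrix (Fin 2) (Fin 2) ℝ) 0 0
              + ∑ j, lam j ^ 2 * (W j : Matrix (Fin 2) (Fin 2) ℝ) 0 0)) • Qmat)
    (ρ : ℝ)
    (hρ : Filter.Tendsto (fun n : ℕ => ‖T ^ n‖ ^ ((n : ℝ)⁻¹)) Filter.atTop (nhds ρ)) :
    ρ < 1 ↔ η * lam ⟨0, hd⟩ < 1 - β ^ 2 ∧
      ∑ i, η * lam i / (2 * (1 - β) * (1 - η * lam i / (1 - β ^ 2))) < 1 := by
  have hT' : ZEq η β lam T := hT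
  constructor
  · intro h
    obtain ⟨W, h0, hW⟩ := zsolve hT' ρ hρ h
    exact zforward hd hη hβ hpos hT' W h0 hW
  · rintro ⟨hl, hS⟩
    have hl' : ∀ i, η * lam i < 1 - β ^ 2 := fun i =>
      (mul_le_mul_of_nonneg_left (hmono (Fin.mk_le_of_le_val (Nat.zero_le _))) hη.le).trans_lt hl
    obtain ⟨W, ε, hε, hW, h⟩ := zbackward hη hβ hpos hT' hl' hS
    obtain ⟨K, θ, hK, hθ0, hθ1, hb⟩ := zbound hT' W ε hε hW h
    exact zrho_lt ρ hρ K θ hK hθ0 hθ1 hb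
end

section
/- Let M be the local covariance map on 𝕊² defined by M(X) = A X Aᵀ + η²λ² X_{11} Q, where A = [[1−ηλ, −β],[ηλ, β]], Q = [[1,−1],[−1,1]], ηλ > 0, and β ∈ [0,1). Then the spectral radius of M satisfies ρ(M) < 1 if and only if ηλ < 1 − β². -/
open Matrix

lemma exists_lyap (a β : ℝ) (ha : 0 < a) (h0 : 0 ≤ β) (h1 : β < 1) (h : a < 1 - β ^ 2) :
    ∃ p q r θ δ : ℝ, 0 < δ ∧ 0 ≤ θ ∧ θ < 1 ∧
      (∀ x y : ℝ, δ * (x ^ 2 + y ^ 2) ≤ p * (x - y) ^ 2 + 2 * q * (x - y) * y + r * y ^ 2) ∧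
      (∀ t y : ℝ, p * ((1 + β - a) * t + y) ^ 2 + 2 * q * ((1 + β - a) * t + y) * (-β * t)
          + r * (-β * t) ^ 2 + a ^ 2 * p * t ^ 2
          ≤ θ * (p * t ^ 2 + 2 * q * t * y + r * y ^ 2)) := by
  have hφ : 0 < 2 * a * (1 - β ^ 2 - a) := by
    have : 0 < 1 - β ^ 2 - a := by linarith
    positivity
  have hb : 0 < 1 + β := by linarith
  obtain ⟨p, hp⟩ : ∃ p, p = (1 + β) * (1 + β ^ 2) / (2 * a * (1 - β ^ 2 - a)) := ⟨_, rfl⟩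
  have hp0 : 0 < p := by rw [hp]; positivity
  have hpe : p * (2 * a * (1 - β ^ 2 - a)) = (1 + β) * (1 + β ^ 2) := by
    rw [hp]; exact div_mul_cancel₀ _ hφ.ne'
  obtain ⟨q, hq⟩ : ∃ q, q = (1 + β - a) * p / (1 + β) := ⟨_, rfl⟩
  have hqe : q * (1 + β) = (1 + β - a) * p := by
    rw [hq]; exact div_mul_cancel₀ _ hb.ne'
  have hqp : q ^ 2 < p * (p + 1) := by
    have e1 : q < p := by
      rw [hq, div_lt_iff₀ hb]; nlinarith
    have e2 : -p < q := by
      rw [hq, lt_div_iff₀ hb]; nlinarith [mul_pos hp0 (show 0 < 2 * (1 + β) - a by nlinarith)]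
    nlinarith
  have key : p * (1 + β - a) ^ 2 - 2 * q * β * (1 + β - a) + (p + 1) * β ^ 2 + a ^ 2 * p
      = p - 1 := by
    apply mul_right_cancel₀ hb.ne'
    linear_combination (-2 * β * (1 + β - a)) * hqe - hpe
  have hK : 0 < p + (p + 1) := by linarith
  have hD : 0 < p * (p + 1) - q ^ 2 := by linarith
  refine ⟨p, q, p + 1, 1 - 1 / (p + (p + 1)), (p * (p + 1) - q ^ 2) / (3 * (p + (p + 1))),
    by positivity, ?_, ?_, ?_, ?_⟩
  · have : 1 / (p + (p + 1)) ≤ 1 := by rw [div_le_one hK]; linarith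
    linarith
  · have : 0 < 1 / (p + (p + 1)) := by positivity
    linarith
  · intro x y
    rw [div_mul_eq_mul_div, div_le_iff₀ (by positivity)]
    obtain ⟨t, rfl⟩ : ∃ t, x = t + y := ⟨x - y, by ring⟩
    have e1 : (t + y) ^ 2 + y ^ 2 ≤ 3 * (t ^ 2 + y ^ 2) := by
      nlinarith [sq_nonneg (2 * t - y), sq_nonneg (t - y)]
    have e2 := mul_le_mul_of_nonneg_left e1 hD.le
    have e3 := sq_nonneg (p * t + q * y)
    have e4 := sq_nonneg (q * t + (p + 1) * y)
    have e5 : t + y - y = t := by ring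
    rw [e5]
    nlinarith
  · intro t y
    have e : p * ((1 + β - a) * t + y) ^ 2 + 2 * q * ((1 + β - a) * t + y) * (-β * t)
          + (p + 1) * (-β * t) ^ 2 + a ^ 2 * p * t ^ 2
        = (p * t ^ 2 + 2 * q * t * y + (p + 1) * y ^ 2) - (t ^ 2 + y ^ 2) := by
      linear_combination t ^ 2 * key - 2 * t * y * hqe
    rw [e]
    have e2 : (p * t ^ 2 + 2 * q * t * y + (p + 1) * y ^ 2) / (p + (p + 1)) ≤ t ^ 2 + y ^ 2 := by
      rw [div_le_iff₀ hK]
      have : (q * t) * y * 2 ≤ (p + 1) * t ^ 2 + p * y ^ 2 := by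
        have h3 : 0 ≤ (p + 1) * ((p + 1) * t ^ 2 + p * y ^ 2 - (q * t) * y * 2) := by
          nlinarith [sq_nonneg ((p + 1) * t - q * y), mul_nonneg hD.le (sq_nonneg y)]
        have := nonneg_of_mul_nonneg_right h3 (by linarith)
        linarith
      nlinarith
    have e3 : (1 - 1 / (p + (p + 1))) * (p * t ^ 2 + 2 * q * t * y + (p + 1) * y ^ 2)
      = (p * t ^ 2 + 2 * q * t * y + (p + 1) * y ^ 2)
        - (p * t ^ 2 + 2 * q * t * y + (p + 1) * y ^ 2) / (p + (p + 1)) := by ring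
    rw [e3]; linarith

/-- Existence of a real eigenvalue at least one in the unstable regime. -/
lemma exists_root (a β : ℝ) (ha : 0 < a) (h0 : 0 ≤ β) (h1 : β < 1) (h : 1 - β ^ 2 ≤ a) :
    ∃ t : ℝ, 1 ≤ t ∧ t * (t + β) * (t - (1 + β - a) ^ 2 - a ^ 2)
      + 2 * β * (1 + β - a) ^ 2 * t - β ^ 2 * (t + β) = 0 := by
  set f : ℝ → ℝ := fun t => t * (t + β) * (t - (1 + β - a) ^ 2 - a ^ 2)
      + 2 * β * (1 + β - a) ^ 2 * t - β ^ 2 * (t + β) with hf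
  obtain ⟨T, hT⟩ : ∃ T, T = 2 + (1 + β - a) ^ 2 + a ^ 2 := ⟨_, rfl⟩
  have hT2 : 2 ≤ T := by rw [hT]; nlinarith [sq_nonneg (1 + β - a), sq_nonneg a]
  have f1 : f 1 ≤ 0 := by
    have : f 1 = 2 * a * (1 - β ^ 2 - a) := by simp only [hf]; ring
    rw [this]; nlinarith
  have fT : 0 ≤ f T := by
    have e : f T = (2 * T - β ^ 2) * (T + β) + 2 * β * (1 + β - a) ^ 2 * T := by
      simp only [hf]
      linear_combination (T * (T + β)) * hT
    rw [e]
    have : 0 ≤ 2 * T - β ^ 2 := by nlinarith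
    positivity
  have hc : ContinuousOn f (Set.Icc 1 T) := by fun_prop
  obtain ⟨t, ht, hft⟩ := intermediate_value_Icc (by linarith : (1 : ℝ) ≤ T) hc ⟨f1, fT⟩
  exact ⟨t, ht.1, hft⟩

/-- Quadratic form of a matrix. -/
def qf (X : Matrix (Fin 2) (Fin 2) ℝ) (x y : ℝ) : ℝ :=
  X 0 0 * x ^ 2 + 2 * X 0 1 * x * y + X 1 1 * y ^ 2

lemma sym_entry (X : Sym2Mat) : (X : Matrix (Fin 2) (Fin 2) ℝ) 1 0
    = (X : Matrix (Fin 2) (Fin 2) ℝ) 0 1 := by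
  have : (X : Matrix (Fin 2) (Fin 2) ℝ)ᵀ = X := X.2
  exact congrFun (congrFun this 0) 1

lemma entry_le_norm (X : Sym2Mat) (i j : Fin 2) :
    |(X : Matrix (Fin 2) (Fin 2) ℝ) i j| ≤ ‖X‖ := by
  have h1 := norm_le_pi_norm (show Fin 2 → Fin 2 → ℝ from (X : Matrix (Fin 2) (Fin 2) ℝ)) i
  have h2 := norm_le_pi_norm ((show Fin 2 → Fin 2 → ℝ from (X : Matrix (Fin 2) (Fin 2) ℝ)) i) j
  exact h2.trans h1

lemma norm_le_of_entry (X : Sym2Mat) (c : ℝ) (hc : 0 ≤ c)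
    (h : ∀ i j, |(X : Matrix (Fin 2) (Fin 2) ℝ) i j| ≤ c) : ‖X‖ ≤ c := by
  have : ‖(show Fin 2 → Fin 2 → ℝ from (X : Matrix (Fin 2) (Fin 2) ℝ))‖ ≤ c :=
    (pi_norm_le_iff_of_nonneg hc).2 fun i => (pi_norm_le_iff_of_nonneg hc).2 fun j => h i j
  exact this

lemma abs_qf_le (X : Sym2Mat) (x y : ℝ) : |qf X x y| ≤ 2 * ‖X‖ * (x ^ 2 + y ^ 2) := by
  have h0 := abs_le.1 (entry_le_norm X 0 0)
  have h1 := abs_le.1 (entry_le_norm X 0 1)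
  have h2 := abs_le.1 (entry_le_norm X 1 1)
  have hs1 := sq_nonneg (x + y)
  have hs2 := sq_nonneg (x - y)
  unfold qf
  rw [abs_le]
  constructor
  · nlinarith [mul_nonneg (sub_nonneg.2 h0.1) (sq_nonneg x),
      mul_nonneg (sub_nonneg.2 h2.1) (sq_nonneg y),
      mul_nonneg (sub_nonneg.2 h1.1) hs1, mul_nonneg (sub_nonneg.2 h1.2) hs2]
  · nlinarith [mul_nonneg (sub_nonneg.2 h0.2) (sq_nonneg x),
      mul_nonneg (sub_nonneg.2 h2.2) (sq_nonneg y),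
      mul_nonneg (sub_nonneg.2 h1.2) hs1, mul_nonneg (sub_nonneg.2 h1.1) hs2]

lemma qf_step (η l β : ℝ) (X Z : Sym2Mat)
    (hM : (Z : Matrix (Fin 2) (Fin 2) ℝ)
        = Amat η β l * (X : Matrix (Fin 2) (Fin 2) ℝ) * (Amat η β l)ᵀ
          + (η ^ 2 * l ^ 2 * (X : Matrix (Fin 2) (Fin 2) ℝ) 0 0) • Qmat) (x y : ℝ) :
    qf Z x y = qf X ((1 - η * l) * x + η * l * y) (-β * (x - y))
      + (η * l) ^ 2 * (x - y) ^ 2 * qf X 1 0 := by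
  have hs := sym_entry X
  unfold qf
  rw [hM]
  simp only [Matrix.add_apply, Matrix.mul_apply, Fin.sum_univ_two, Matrix.transpose_apply]
  simp [Amat, Qmat, hs]
  ring

lemma norm_pow_bound (η l β : ℝ) (hη : 0 < η) (hl : 0 < l)
    (hβ : β ∈ Set.Ico (0 : ℝ) 1)
    (M : Sym2Mat →L[ℝ] Sym2Mat)
    (hM : ∀ X : Sym2Mat, ((M X : Matrix (Fin 2) (Fin 2) ℝ))
        = Amat η β l * (X : Matrix (Fin 2) (Fin 2) ℝ) * (Amat η β l)ᵀ
          + (η ^ 2 * l ^ 2 * (X : Matrix (Fin 2) (Fin 2) ℝ) 0 0) • Qmat)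
    (h : η * l < 1 - β ^ 2) :
    ∃ C θ : ℝ, 0 < C ∧ 0 ≤ θ ∧ θ < 1 ∧ ∀ n : ℕ, ‖M ^ n‖ ≤ C * θ ^ n := by
  obtain ⟨p, q, r, θ, δ, hδ, hθ0, hθ1, hlow, hstep⟩ :=
    exists_lyap (η * l) β (mul_pos hη hl) hβ.1 hβ.2 h
  obtain ⟨G, hG⟩ : ∃ G : ℝ → ℝ → ℝ, ∀ x y, G x y =
    p * (x - y) ^ 2 + 2 * q * (x - y) * y + r * y ^ 2 := ⟨_, fun _ _ => rfl⟩
  have hG0 : ∀ x y, 0 ≤ G x y := fun x y => by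
    rw [hG]; exact le_trans (by positivity) (hlow x y)
  have main : ∀ (X : Sym2Mat) (n : ℕ) (x y : ℝ),
      |qf ((M ^ n) X : Sym2Mat) x y| ≤ (2 * ‖X‖ / δ) * θ ^ n * G x y := by
    intro X n
    induction n with
    | zero =>
      intro x y
      have h1 := abs_qf_le X x y
      have h2 := hlow x y
      rw [← hG] at h2
      have h3 : 2 * ‖X‖ * (x ^ 2 + y ^ 2) ≤ (2 * ‖X‖ / δ) * G x y := by
        have := mul_le_mul_of_nonneg_left h2 (show 0 ≤ 2 * ‖X‖ / δ by positivity)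
        have e : 2 * ‖X‖ / δ * (δ * (x ^ 2 + y ^ 2)) = 2 * ‖X‖ * (x ^ 2 + y ^ 2) := by
          field_simp
        linarith
      simpa using h1.trans h3
    | succ n ih =>
      intro x y
      have e : (M ^ (n + 1)) X = M ((M ^ n) X) := by
        rw [pow_succ']; rfl
      rw [e, qf_step η l β _ _ (hM _) x y]
      have i1 := ih ((1 - η * l) * x + η * l * y) (-β * (x - y))
      have i2 := ih 1 0
      have hs := hstep (x - y) y
      rw [← hG x y] at hs
      have g1 : G 1 0 = p := by rw [hG]; ring
      have g2 : G ((1 - η * l) * x + η * l * y) (-β * (x - y)) + (η * l) ^ 2 * (x - y) ^ 2 * G 1 0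
          ≤ θ * G x y := by
        rw [g1, hG]
        refine le_trans (le_of_eq ?_) hs
        ring
      have hk : 0 ≤ (2 * ‖X‖ / δ) * θ ^ n := by positivity
      calc _ ≤ |qf ((M ^ n) X : Sym2Mat) ((1 - η * l) * x + η * l * y) (-β * (x - y))|
            + |(η * l) ^ 2 * (x - y) ^ 2 * qf ((M ^ n) X : Sym2Mat) 1 0| := abs_add_le _ _
        _ = |qf ((M ^ n) X : Sym2Mat) ((1 - η * l) * x + η * l * y) (-β * (x - y))|
            + (η * l) ^ 2 * (x - y) ^ 2 * |qf ((M ^ n) X : Sym2Mat) 1 0| := by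
            rw [abs_mul, abs_of_nonneg (show 0 ≤ (η * l) ^ 2 * (x - y) ^ 2 by positivity)]
        _ ≤ (2 * ‖X‖ / δ) * θ ^ n * G ((1 - η * l) * x + η * l * y) (-β * (x - y))
            + (η * l) ^ 2 * (x - y) ^ 2 * ((2 * ‖X‖ / δ) * θ ^ n * G 1 0) := by gcongr
        _ = (2 * ‖X‖ / δ) * θ ^ n * (G ((1 - η * l) * x + η * l * y) (-β * (x - y))
            + (η * l) ^ 2 * (x - y) ^ 2 * G 1 0) := by ring
        _ ≤ (2 * ‖X‖ / δ) * θ ^ n * (θ * G x y) := mul_le_mul_of_nonneg_left g2 hk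
        _ = _ := by ring
  obtain ⟨S, hS⟩ : ∃ S, S = G 1 0 + G 0 1 + G 1 1 := ⟨_, rfl⟩
  have hS0 : 0 ≤ S := by rw [hS]; linarith [hG0 1 0, hG0 0 1, hG0 1 1]
  refine ⟨2 / δ * S + 1, θ, by positivity, hθ0, hθ1, fun n => ?_⟩
  have hθn : 0 ≤ θ ^ n := by positivity
  refine ContinuousLinearMap.opNorm_le_bound _ (by positivity) fun X => ?_
  have hk : 0 ≤ (2 * ‖X‖ / δ) * θ ^ n := by positivity
  have hX := norm_nonneg X
  have a1 := main X n 1 0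
  have a2 := main X n 0 1
  have a3 := main X n 1 1
  have s : (2 * ‖X‖ / δ) * θ ^ n * S ≤ (2 / δ * S + 1) * θ ^ n * ‖X‖ := by
    have : (2 / δ * S + 1) * θ ^ n * ‖X‖ = (2 * ‖X‖ / δ) * θ ^ n * S + θ ^ n * ‖X‖ := by ring
    rw [this]; nlinarith
  have b1 := mul_nonneg hk (hG0 1 0)
  have b2 := mul_nonneg hk (hG0 0 1)
  have b3 := mul_nonneg hk (hG0 1 1)
  have s' : (2 * ‖X‖ / δ) * θ ^ n * S = (2 * ‖X‖ / δ) * θ ^ n * G 1 0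
    + (2 * ‖X‖ / δ) * θ ^ n * G 0 1 + (2 * ‖X‖ / δ) * θ ^ n * G 1 1 := by rw [hS]; ring
  have hsym := sym_entry ((M ^ n) X)
  refine le_trans (norm_le_of_entry _ _ (mul_nonneg hk hS0) fun i j => ?_) s
  rw [s']
  simp only [qf, abs_le] at a1 a2 a3
  rw [abs_le]
  obtain ⟨a1, a1'⟩ := a1
  obtain ⟨a2, a2'⟩ := a2
  obtain ⟨a3, a3'⟩ := a3
  fin_cases i <;> fin_cases j <;> simp only [Fin.zero_eta, Fin.mk_one, hsym] <;>
    constructor <;> linarith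

/-- Eigenvector lower bound on the powers. -/
lemma one_le_norm_pow (η l β : ℝ) (hη : 0 < η) (hl : 0 < l)
    (hβ : β ∈ Set.Ico (0 : ℝ) 1)
    (M : Sym2Mat →L[ℝ] Sym2Mat)
    (hM : ∀ X : Sym2Mat, ((M X : Matrix (Fin 2) (Fin 2) ℝ))
        = Amat η β l * (X : Matrix (Fin 2) (Fin 2) ℝ) * (Amat η β l)ᵀ
          + (η ^ 2 * l ^ 2 * (X : Matrix (Fin 2) (Fin 2) ℝ) 0 0) • Qmat)
    (h : 1 - β ^ 2 ≤ η * l) (n : ℕ) : 1 ≤ ‖M ^ n‖ := by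
  obtain ⟨t, ht, hroot⟩ := exists_root (η * l) β (mul_pos hη hl) hβ.1 hβ.2 h
  have hβ0 := hβ.1
  obtain ⟨p, hp⟩ : ∃ p, p = t * (t + β) := ⟨_, rfl⟩
  obtain ⟨q, hq⟩ : ∃ q, q = (1 + β - η * l) * t := ⟨_, rfl⟩
  obtain ⟨r, hr⟩ : ∃ r, r = t + β := ⟨_, rfl⟩
  let X : Sym2Mat := ⟨!![p, q - p; q - p, r - 2 * q + p], by
    show Matrix.IsSymm _
    ext i j; fin_cases i <;> fin_cases j <;> rfl⟩
  have hXe : M X = t • X := by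
    apply Subtype.ext
    rw [hM]
    show _ = t • (X : Matrix (Fin 2) (Fin 2) ℝ)
    ext i j
    fin_cases i <;> fin_cases j <;>
      simp only [Matrix.add_apply, Matrix.mul_apply, Fin.sum_univ_two, Matrix.transpose_apply] <;>
      simp [X, Amat, Qmat, hp, hq, hr]
    · linear_combination -hroot
    · linear_combination hroot
    · linear_combination hroot
    · linear_combination -hroot
  have hpow : (M ^ n) X = t ^ n • X := by
    induction n with
    | zero => simp
    | succ n ih =>
      have e : (M ^ (n + 1)) X = M ((M ^ n) X) := by
        rw [pow_succ']; rfl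
      rw [e, ih, map_smul, hXe, smul_smul, pow_succ]
  have hX0 : 0 < ‖X‖ := by
    have h1 := entry_le_norm X 0 0
    have h2 : (X : Matrix (Fin 2) (Fin 2) ℝ) 0 0 = p := rfl
    have h3 : 0 < p := by rw [hp]; positivity
    rw [h2, abs_of_pos h3] at h1
    linarith
  have hb := (M ^ n).le_opNorm X
  rw [hpow, norm_smul] at hb
  have h1 : 1 ≤ ‖t ^ n‖ := by
    rw [Real.norm_eq_abs, abs_of_nonneg (by positivity)]
    exact one_le_pow₀ ht
  exact h1.trans (le_of_mul_le_mul_right hb hX0)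

/-- **Spectral radius of the local covariance map.**  Let `M` be the local covariance map
on `𝕊²`, `M(X) = A X Aᵀ + η²λ² X₁₁ Q`, and let `ρ` be its spectral radius (the limit of
`‖Mⁿ‖^{1/n}`).  Then `ρ < 1 ↔ ηλ < 1 − β²`. -/
theorem local_cov_map_spectral_radius_lt_one (η l β : ℝ) (hη : 0 < η) (hl : 0 < l)
    (hβ : β ∈ Set.Ico (0 : ℝ) 1)
    (M : Sym2Mat →L[ℝ] Sym2Mat)
    (hM : ∀ X : Sym2Mat, ((M X : Matrix (Fin 2) (Fin 2) ℝ))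
        = Amat η β l * (X : Matrix (Fin 2) (Fin 2) ℝ) * (Amat η β l)ᵀ
          + (η ^ 2 * l ^ 2 * (X : Matrix (Fin 2) (Fin 2) ℝ) 0 0) • Qmat)
    (ρ : ℝ)
    (hρ : Filter.Tendsto (fun n : ℕ => ‖M ^ n‖ ^ ((n : ℝ)⁻¹)) Filter.atTop (nhds ρ)) :
    ρ < 1 ↔ η * l < 1 - β ^ 2 := by
  constructor
  · intro hlt
    by_contra hcon
    push Not at hcon
    refine absurd (ge_of_tendsto' hρ fun n => ?_) (not_le.2 hlt)
    exact Real.one_le_rpow (one_le_norm_pow η l β hη hl hβ M hM hcon n) (by positivity)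
  · intro h
    obtain ⟨C, θ, hC, hθ0, hθ1, hb⟩ := norm_pow_bound η l β hη hl hβ M hM h
    have hlim : Filter.Tendsto (fun n : ℕ => C ^ ((n : ℝ)⁻¹) * θ) Filter.atTop (nhds θ) := by
      have h1 : Filter.Tendsto (fun n : ℕ => ((n : ℝ)⁻¹)) Filter.atTop (nhds 0) :=
        tendsto_inv_atTop_nhds_zero_nat
      have h2 := ((Real.continuousAt_const_rpow hC.ne' (b := 0)).tendsto.comp h1).mul_const θ
      simpa using h2
    refine lt_of_le_of_lt (le_of_tendsto_of_tendsto hρ hlim ?_) hθ1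
    filter_upwards [Filter.eventually_ge_atTop 1] with n hn
    calc ‖M ^ n‖ ^ ((n : ℝ)⁻¹) ≤ (C * θ ^ n) ^ ((n : ℝ)⁻¹) :=
          Real.rpow_le_rpow (ContinuousLinearMap.opNorm_nonneg _) (hb n) (by positivity)
      _ = C ^ ((n : ℝ)⁻¹) * θ := by
          rw [Real.mul_rpow hC.le (by positivity),
            Real.pow_rpow_inv_natCast hθ0 (by omega)]
end
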